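/- For any two-element initial store IS, no compositional translation τ from SYNCSIMPLE to LOCKSIMPLE_{2,IS} is correct; i.e., two locks (with blocking put and non-blocking take) are insufficient to correctly encode synchronous communication preserving and reflecting may- and must-convergence, while three locks suffice. -/

import Mathlib

/-- Symbols of SYNCSIMPLE: `!` (bang) and `?` (ques). -/
inductive SSym | bang | ques
deriving DecidableEq

/-- A SYNCSIMPLE subprocess: a string over {!,?} ending with `0` (false) or `✓` (true). -/
abbrev SSub := List SSym × Bool

/-- A SYNCSIMPLE process: a multiset of subprocesses. -/
abbrev SProc := Multiset SSub

/-- The SYS reduction: a leading `!` and a leading `?` of two subprocesses are consumed. -/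
def SysStep (P Q : SProc) : Prop :=
  ∃ (u1 u2 : List SSym) (b1 b2 : Bool) (R : SProc),
    P = (SSym.bang :: u1, b1) ::ₘ (SSym.ques :: u2, b2) ::ₘ R ∧
    Q = (u1, b1) ::ₘ (u2, b2) ::ₘ R

/-- A process is successful if it contains the subprocess `✓`. -/
def SSuccessful (P : SProc) : Prop := (([], true) : SSub) ∈ P

def SMayConv (P : SProc) : Prop :=
  ∃ Q, Relation.ReflTransGen SysStep P Q ∧ SSuccessful Q

def SMustConv (P : SProc) : Prop :=
  ∀ Q, Relation.ReflTransGen SysStep P Q → SMayConv Q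

/-- Lock operations: put `P_i` and take `T_i`. -/
inductive LOp | put | take
deriving DecidableEq

abbrev LSym (k : ℕ) := LOp × Fin k
abbrev LSub (k : ℕ) := List (LSym k) × Bool
abbrev LProc (k : ℕ) := Multiset (LSub k)
/-- The store of `k` locks: `true` = full (■), `false` = empty (□). -/
abbrev Store (k : ℕ) := Fin k → Bool

/-- LOCKSIMPLE step: `P_i` fills an empty lock `i` (blocks if full);
    `T_i` empties lock `i` and never blocks. -/
def LockStep {k : ℕ} : (LProc k × Store k) → (LProc k × Store k) → Prop :=
  fun s t => ∃ (i : Fin k) (u : List (LSym k)) (b : Bool) (R : LProc k),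
    ((s.1 = ((LOp.put, i) :: u, b) ::ₘ R ∧ s.2 i = false ∧
      t.1 = (u, b) ::ₘ R ∧ t.2 = Function.update s.2 i true) ∨
     (s.1 = ((LOp.take, i) :: u, b) ::ₘ R ∧
      t.1 = (u, b) ::ₘ R ∧ t.2 = Function.update s.2 i false))

def LSuccessful {k : ℕ} (s : LProc k × Store k) : Prop := (([], true) : LSub k) ∈ s.1

def LMayConv {k : ℕ} (s : LProc k × Store k) : Prop :=
  ∃ t, Relation.ReflTransGen LockStep s t ∧ LSuccessful t

def LMustConv {k : ℕ} (s : LProc k × Store k) : Prop :=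
  ∀ t, Relation.ReflTransGen LockStep s t → LMayConv t

/-- The compositional translation determined by the strings `tb = τ(!)` and `tq = τ(?)`,
    applied to a subprocess. -/
def transSub {k : ℕ} (tb tq : List (LSym k)) (u : SSub) : LSub k :=
  (u.1.flatMap (fun c => match c with | SSym.bang => tb | SSym.ques => tq), u.2)

/-- The compositional translation applied to a process. -/
def transProc {k : ℕ} (tb tq : List (LSym k)) (P : SProc) : LProc k :=
  P.map (transSub tb tq)

/-- Correctness of the compositional translation `(tb, tq)` with initial store `IS`:
    may- and must-convergence are preserved and reflected. -/
def Correct {k : ℕ} (IS : Store k) (tb tq : List (LSym k)) : Prop :=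
  ∀ P : SProc,
    (SMayConv P ↔ LMayConv (transProc tb tq P, IS)) ∧
    (SMustConv P ↔ LMustConv (transProc tb tq P, IS))

/-- The solo execution of the string `s` from store `IS` reaches the point where
    `(put, i) :: rest` remains and deadlocks there since lock `i` is full. -/
def SoloBlocked {k : ℕ} (IS : Store k) (s : List (LSym k)) (i : Fin k)
    (rest : List (LSym k)) : Prop :=
  ∃ C : Store k,
    Relation.ReflTransGen LockStep (({(s, false)} : LProc k), IS)
      (({((LOp.put, i) :: rest, false)} : LProc k), C) ∧
    C i = true

/-- Blocking type `P_i`: the blocking prefix is `R P_i` with `R` free of `P_i, T_i`. -/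
def BlockingTypeP {k : ℕ} (IS : Store k) (s : List (LSym k)) (i : Fin k) : Prop :=
  ∃ r rest, s = r ++ (LOp.put, i) :: rest ∧ (∀ x ∈ r, x.2 ≠ i) ∧
    SoloBlocked IS s i rest

/-- Blocking type `P_i P_i`: the blocking prefix is `R₁ P_i R₂ P_i` with
    `R₂` free of `P_i, T_i`, deadlocking exactly before the last `P_i`. -/
def BlockingTypePP {k : ℕ} (IS : Store k) (s : List (LSym k)) (i : Fin k) : Prop :=
  ∃ r1 r2 rest, s = r1 ++ (LOp.put, i) :: r2 ++ (LOp.put, i) :: rest ∧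
    (∀ x ∈ r2, x.2 ≠ i) ∧ SoloBlocked IS s i rest

def tb3 : List (LSym 3) :=
  [(LOp.put, 0), (LOp.take, 2), (LOp.put, 1), (LOp.take, 0)]
def tq3 : List (LSym 3) := [(LOp.put, 2), (LOp.take, 1)]
def IS3 : Store 3 := ![false, true, true]

namespace TL
open Relation

section basics
variable {k : ℕ}

/-- Solo execution of a string. -/
def run : List (LSym k) → Store k → Option (Store k)
  | [], s => some s
  | (LOp.put, i) :: u, s => if s i = true then none else run u (Function.update s i true)
  | (LOp.take, i) :: u, s => run u (Function.update s i false)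

abbrev Reach (X Y : LProc k × Store k) : Prop := ReflTransGen LockStep X Y

/-- The string `u` cannot move in store `s`. -/
def Blk (s : Store k) (u : List (LSym k)) : Prop :=
  ∀ x v, u = x :: v → x.1 = LOp.put ∧ s x.2 = true

lemma step_put (i : Fin k) (u b R) (s : Store k) (h : s i = false) :
    LockStep (((LOp.put, i) :: u, b) ::ₘ R, s) ((u, b) ::ₘ R, Function.update s i true) :=
  ⟨i, u, b, R, Or.inl ⟨rfl, h, rfl, rfl⟩⟩

lemma step_take (i : Fin k) (u b R) (s : Store k) :
    LockStep (((LOp.take, i) :: u, b) ::ₘ R, s) ((u, b) ::ₘ R, Function.update s i false) :=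
  ⟨i, u, b, R, Or.inr ⟨rfl, rfl, rfl⟩⟩

lemma reach_run {w : List (LSym k)} : ∀ {s t : Store k}, run w s = some t → ∀ u b R,
    Reach ((w ++ u, b) ::ₘ R, s) ((u, b) ::ₘ R, t) := by
  induction w with
  | nil => intro s t h u b R; simp only [run, Option.some.injEq] at h; subst h; exact .refl
  | cons x w ih =>
    intro s t h u b R
    obtain ⟨op, i⟩ := x
    cases op with
    | put =>
      simp only [run] at h
      split_ifs at h with hs
      exact ReflTransGen.head (step_put i _ b R s (by simpa using hs)) (ih h u b R)
    | take =>
      simp only [run] at h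
      exact ReflTransGen.head (step_take i _ b R s) (ih h u b R)

lemma run_append (u v : List (LSym k)) : ∀ s, run (u ++ v) s = (run u s).bind (run v) := by
  induction u with
  | nil => intro s; simp [run]
  | cons x u ih =>
    intro s
    obtain ⟨op, i⟩ := x
    cases op
    · simp only [List.cons_append, run]; split_ifs <;> simp [ih]
    · simp only [List.cons_append, run, ih]

lemma run_none {w : List (LSym k)} : ∀ {s : Store k}, run w s = none →
    ∃ w1 i w2 t, w = w1 ++ (LOp.put, i) :: w2 ∧ run w1 s = some t ∧ t i = true := by
  induction w with
  | nil => intro s h; simp [run] at h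
  | cons x w ih =>
    intro s h
    obtain ⟨op, i⟩ := x
    cases op with
    | put =>
      simp only [run] at h
      split_ifs at h with hs
      · exact ⟨[], i, w, s, rfl, rfl, hs⟩
      · obtain ⟨w1, j, w2, t, rfl, h1, h2⟩ := ih h
        exact ⟨(LOp.put, i) :: w1, j, w2, t, rfl, by simp [run, hs, h1], h2⟩
    | take =>
      simp only [run] at h
      obtain ⟨w1, j, w2, t, rfl, h1, h2⟩ := ih h
      exact ⟨(LOp.take, i) :: w1, j, w2, t, rfl, by simp [run, h1], h2⟩

lemma blk_nil (s : Store k) : Blk s [] := by intro x v h; simp at h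

lemma blk_put {s : Store k} {i} (h : s i = true) (u) : Blk s ((LOp.put, i) :: u) := by
  intro x v hx; simp only [List.cons.injEq] at hx; obtain ⟨rfl, rfl⟩ := hx; exact ⟨rfl, h⟩

/-- Maximal solo run. -/
lemma norm_run (w : List (LSym k)) (s : Store k) :
    ∃ w1 w2 t, w = w1 ++ w2 ∧ run w1 s = some t ∧ Blk t w2 := by
  cases h : run w s with
  | some t => exact ⟨w, [], t, by simp, h, blk_nil t⟩
  | none =>
    obtain ⟨w1, i, w2, t, hw, h1, h2⟩ := run_none h
    exact ⟨w1, _, t, hw, h1, blk_put h2 _⟩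

lemma dead {P : LProc k} {s : Store k} (h : ∀ t ∈ P, Blk s t.1)
    (h' : (([], true) : LSub k) ∉ P) : ¬ LMayConv (P, s) := by
  rintro ⟨t, hr, hs⟩
  rcases ReflTransGen.cases_head hr with rfl | ⟨Y, ⟨i, u, b, R, hstep⟩, -⟩
  · exact h' hs
  · rcases hstep with ⟨h1, h2, -, -⟩ | ⟨h1, -, -⟩
    · have := h _ (by simp only at h1; rw [h1]; exact Multiset.mem_cons_self _ _) _ _ rfl
      simp_all
    · have := h _ (by simp only at h1; rw [h1]; exact Multiset.mem_cons_self _ _) _ _ rfl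
      simp_all

lemma not_must {X Y : LProc k × Store k} (h : Reach X Y) (hY : ¬ LMayConv Y) : ¬ LMustConv X :=
  fun hm => hY (hm Y h)

lemma not_must_trans {X Y : LProc k × Store k} (h : Reach X Y) (hY : ¬ LMustConv Y) :
    ¬ LMustConv X := fun hm => hY (fun t ht => hm t (h.trans ht))

lemma bulk_fix {w : List (LSym k)} {s : Store k} (h : run w s = some s) (u c) (n : ℕ) : ∀ R,
    Reach (Multiset.replicate n (w ++ u, c) + R, s) (Multiset.replicate n (u, c) + R, s) := by
  induction n with
  | zero => intro R; simpa using ReflTransGen.refl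
  | succ n ih =>
    intro R
    rw [Multiset.replicate_succ, Multiset.replicate_succ, Multiset.cons_add, Multiset.cons_add]
    refine (reach_run h u c _).trans ?_
    have := ih ((u, c) ::ₘ R)
    simpa only [Multiset.add_cons] using this

lemma bulk_two {w : List (LSym k)} {s s1 : Store k} (h : run w s = some s1)
    (h1 : run w s1 = some s1) (n : ℕ) : ∃ s', (0 < n → s' = s1) ∧ ∀ u c R,
    Reach (Multiset.replicate n (w ++ u, c) + R, s) (Multiset.replicate n (u, c) + R, s') := by
  cases n with
  | zero => exact ⟨s, by simp, fun u c R => by simpa using ReflTransGen.refl⟩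
  | succ n =>
    refine ⟨s1, fun _ => rfl, fun u c R => ?_⟩
    rw [Multiset.replicate_succ, Multiset.replicate_succ, Multiset.cons_add, Multiset.cons_add]
    refine (reach_run h u c _).trans ?_
    have := bulk_fix h1 u c n ((u, c) ::ₘ R)
    simpa only [Multiset.add_cons] using this

/-- Number of `T_i` before the first `P_i`. -/
def cnt (i : Fin k) : List (LSym k) → ℕ
  | [] => 0
  | (LOp.put, j) :: u => if j = i then 0 else cnt i u
  | (LOp.take, j) :: u => (if j = i then 1 else 0) + cnt i u

lemma cnt_le (i : Fin k) (u : List (LSym k)) : cnt i u ≤ u.length := by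
  induction u with
  | nil => simp [cnt]
  | cons x u ih =>
    obtain ⟨op, j⟩ := x
    cases op <;> simp only [cnt, List.length_cons] <;> split_ifs <;> omega

lemma cnt_free {i : Fin k} {W : List (LSym k)} (h : ∀ x ∈ W, x.2 ≠ i) (v) :
    cnt i (W ++ v) = cnt i v := by
  induction W with
  | nil => rfl
  | cons x W ih =>
    obtain ⟨op, j⟩ := x
    have hj : j ≠ i := h (op, j) (by simp)
    have := ih (fun x hx => h x (by simp [hx]))
    cases op <;> simp [cnt, hj, this]

theorem trap (i : Fin k) (α' : List (LSym k)) (c : Bool) (h0 : cnt i α' = 0)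
    (hc : c = true → (LOp.put, i) ∈ α') : ∀ N n (R : LProc k) s,
    n * (α'.length + 1) + (R.map (fun r => r.1.length)).sum ≤ N →
    (R.map (fun r => cnt i r.1)).sum + (if s i = true then 0 else 1) ≤ n →
    (∀ r ∈ R, r.2 = true → (LOp.put, i) ∈ r.1) →
    ¬ LMustConv (Multiset.replicate n ((LOp.put, i) :: α', c) + R, s) := by
  intro N
  induction N with
  | zero =>
    intro n R s hN hn hR
    have hn0 : n = 0 := by
      have : n * (α'.length + 1) = 0 := by omega
      simpa using this
    subst hn0
    have hs : s i = true := by by_contra h; simp [h] at hn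
    refine not_must .refl (dead ?_ ?_)
    · intro t ht
      simp only [Multiset.replicate_zero, zero_add] at ht
      have : t.1.length = 0 := by
        have := Multiset.single_le_sum (s := R.map (fun r => r.1.length)) (by simp) t.1.length
          (Multiset.mem_map_of_mem (fun r : LSub k => r.1.length) ht)
        omega
      rw [List.length_eq_zero_iff] at this
      rw [this]; exact blk_nil s
    · intro h
      simp only [Multiset.replicate_zero, zero_add] at h
      simpa using hR _ h rfl
  | succ N ih =>
    intro n R s hN hn hR
    by_cases hs : s i = true
    · by_cases hd : ∀ t ∈ R, Blk s t.1
      · refine not_must .refl (dead ?_ ?_)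
        · intro t ht
          rcases Multiset.mem_add.1 ht with ht | ht
          · rw [Multiset.eq_of_mem_replicate ht]; exact blk_put hs _
          · exact hd t ht
        · intro ht
          rcases Multiset.mem_add.1 ht with ht | ht
          · simpa using Multiset.eq_of_mem_replicate ht
          · simpa using hR _ ht rfl
      · push Not at hd
        obtain ⟨⟨u, b⟩, hr, hb⟩ := hd
        obtain ⟨R', rfl⟩ := Multiset.exists_cons_of_mem hr
        simp only [Blk, not_forall] at hb
        obtain ⟨⟨op, j⟩, v, rfl, hb⟩ := hb
        have hRv : ∀ r ∈ R', r.2 = true → (LOp.put, i) ∈ r.1 :=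
          fun r hr' => hR r (Multiset.mem_cons_of_mem hr')
        have hv := hR ((op, j) :: v, b) (Multiset.mem_cons_self _ _)
        simp only [Multiset.map_cons, Multiset.sum_cons, List.length_cons] at hN hn
        cases op with
        | put =>
          have hj : s j = false := by simpa using hb
          have hij : j ≠ i := by rintro rfl; simp_all
          have hst := step_put j v b (Multiset.replicate n ((LOp.put, i) :: α', c) + R') s hj
          rw [Multiset.add_cons]
          refine not_must_trans (.single hst) ?_
          rw [← Multiset.add_cons]
          have hs' : Function.update s j true i = true := by
            rw [Function.update_of_ne hij.symm]; exact hs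
          apply ih
          · simp only [Multiset.map_cons, Multiset.sum_cons]; omega
          · simp only [Multiset.map_cons, Multiset.sum_cons, hs', if_true]
            simp only [cnt, hij, hs, if_true, if_false] at hn; omega
          · intro r hr hrt
            rcases Multiset.mem_cons.1 hr with rfl | hr
            · have := hv hrt
              simpa [hij.symm] using this
            · exact hRv r hr hrt
        | take =>
          have hst := step_take j v b (Multiset.replicate n ((LOp.put, i) :: α', c) + R') s
          rw [Multiset.add_cons]
          refine not_must_trans (.single hst) ?_
          rw [← Multiset.add_cons]
          apply ih
          · simp only [Multiset.map_cons, Multiset.sum_cons]; omega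
          · simp only [Multiset.map_cons, Multiset.sum_cons]
            by_cases hij : j = i
            · subst hij
              simp only [cnt, hs, if_true] at hn
              simp; omega
            · rw [Function.update_of_ne (Ne.symm hij)]
              simp only [cnt, hij, hs, if_true, if_false] at hn ⊢; omega
          · intro r hr hrt
            rcases Multiset.mem_cons.1 hr with rfl | hr
            · have := hv hrt
              simpa using this
            · exact hRv r hr hrt
    · have hs : s i = false := by simpa using hs
      cases n with
      | zero => simp [hs] at hn
      | succ n =>
        rw [Multiset.replicate_succ, Multiset.cons_add]
        refine not_must_trans (.single (step_put i α' c _ s hs)) ?_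
        rw [← Multiset.add_cons]
        apply ih
        · simp only [Multiset.map_cons, Multiset.sum_cons]
          have : (n + 1) * (α'.length + 1) = n * (α'.length + 1) + (α'.length + 1) := by ring
          omega
        · simp only [Multiset.map_cons, Multiset.sum_cons, h0]
          simp [hs] at hn
          simp; omega
        · intro r hr hrt
          rcases Multiset.mem_cons.1 hr with rfl | hr
          · exact hc hrt
          · exact hR r hr hrt

end basics

section two
open Multiset

lemma reach_run' {k : ℕ} {w u : List (LSym k)} {s t : Store k} {b : Bool} {P Q : LProc k}
    (h : run w s = some t) (R : LProc k)
    (hP : P = (w ++ u, b) ::ₘ R) (hQ : Q = (u, b) ::ₘ R) : Reach (P, s) (Q, t) := by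
  subst hP hQ; exact reach_run h u b R

structure Facts (IS : Store 2) (A B : List (LSym 2)) : Prop where
  f1 : ∀ n, LMustConv (replicate (n+1) (A, true) + ((B, false) ::ₘ 0), IS)
  f2 : ∀ n, LMustConv (replicate (n+2) (A, false) + ((B, false) ::ₘ (B, true) ::ₘ 0), IS)
  f3 : ∀ n, LMustConv (replicate n (A, false) +
    (((List.replicate n B).flatten, true) ::ₘ 0), IS)
  f3n : ∀ n, ¬ LMayConv (replicate n (A, false) +
    (((List.replicate (n+1) B).flatten, true) ::ₘ 0), IS)
  f4 : LMustConv ((A, true) ::ₘ (A, false) ::ₘ (B, false) ::ₘ (B, false) ::ₘ 0, IS)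

/-- All of `n` copies of `A` can be moved to the suffix `α` using only one copy of `B`. -/
def BulkAt (IS : Store 2) (A B α : List (LSym 2)) (n : ℕ) (b : List (LSym 2)) (s : Store 2) :
    Prop :=
  b.length ≤ B.length ∧ ∀ c c' tl R, Reach (replicate n (A, c) + ((B ++ tl, c') ::ₘ R), IS)
    (replicate n (α, c) + ((b ++ tl, c') ::ₘ R), s)

variable {IS : Store 2} {A B : List (LSym 2)}

lemma bulk_adv {w u b : List (LSym 2)} {n : ℕ} {s s1 : Store 2}
    (h : BulkAt IS A B (w ++ u) (n+1) b s)
    (h1 : run w s = some s1) (h2 : run w s1 = some s1) : BulkAt IS A B u (n+1) b s1 := by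
  obtain ⟨s', hs', hr⟩ := bulk_two h1 h2 (n+1)
  obtain rfl := hs' (by omega)
  exact ⟨h.1, fun c c' tl R => (h.2 c c' tl R).trans (hr _ _ _)⟩

lemma bulk_norm {α b : List (LSym 2)} {n : ℕ} {s : Store 2} (h : BulkAt IS A B α n b s) :
    ∃ b' s', BulkAt IS A B α n b' s' ∧ Blk s' b' := by
  obtain ⟨w1, w2, t, rfl, h1, h2⟩ := norm_run b s
  refine ⟨w2, t, ⟨?_, fun c c' tl R => (h.2 c c' tl R).trans ?_⟩, h2⟩
  · have := h.1; simp at this; omega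
  · refine reach_run' (u := w2 ++ tl) (b := c') h1 (replicate n (α, c) + R) ?_ ?_
    · simp [add_cons]
    · simp [add_cons]

lemma bulk_start (n : ℕ) : BulkAt IS A B A n B IS :=
  ⟨le_rfl, fun _ _ _ _ => .refl⟩

def PutHd (u : List (LSym 2)) : Prop := ∀ x v, u = x :: v → x.1 = LOp.put

lemma Blk.putHd {s u} (h : Blk s u) : PutHd u := fun x v e => (h x v e).1

lemma putHd_cons (i u) : PutHd ((LOp.put, i) :: u) := by
  intro x v h; simp only [List.cons.injEq] at h; rw [← h.1]

lemma putHd_nil : PutHd [] := by intro x v h; simp at h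

lemma blk_full {s : Store 2} {u} (hs : ∀ x, s x = true) (h : PutHd u) : Blk s u :=
  fun x v e => ⟨h x v e, hs _⟩

lemma store_ext {i j : Fin 2} (h : j ≠ i) {s t : Store 2} (h1 : s i = t i) (h2 : s j = t j) :
    s = t := by
  funext x
  have : x = i ∨ x = j := by omega
  rcases this with rfl | rfl <;> assumption

lemma all_full {i j : Fin 2} (h : j ≠ i) {s : Store 2} (h1 : s i = true) (h2 : s j = true) :
    ∀ x, s x = true := by
  intro x
  have : x = i ∨ x = j := by omega
  rcases this with rfl | rfl <;> assumption

lemma run_free {i : Fin 2} {W : List (LSym 2)} (h : ∀ x ∈ W, x.2 ≠ i) : ∀ {s t : Store 2},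
    run W s = some t → t i = s i := by
  induction W with
  | nil => intro s t h; simp [run] at h; rw [h]
  | cons x W ih =>
    intro s t hr
    obtain ⟨op, j⟩ := x
    have hj : i ≠ j := (h (op, j) (by simp)).symm
    have ih := @ih (fun x hx => h x (by simp [hx]))
    cases op
    · simp only [run] at hr
      split_ifs at hr
      rw [ih hr, Function.update_of_ne hj]
    · simp only [run] at hr
      rw [ih hr, Function.update_of_ne hj]

lemma idem {i j : Fin 2} (hij : j ≠ i) {W : List (LSym 2)} (h : ∀ x ∈ W, x.2 ≠ i)
    {s t : Store 2} (hr : run W s = some t) :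
    run W t = some t ∨ (∃ W', W = (LOp.put, j) :: W') ∧ s j = false ∧ t j = true := by
  have hti := run_free h hr
  cases W with
  | nil => left; simp [run]
  | cons x W =>
    obtain ⟨op, j'⟩ := x
    have : j' = j := by
      have := h (op, j') (by simp)
      simp only at this
      omega
    subst this
    cases op with
    | take =>
      left
      simp only [run] at hr ⊢
      rw [← hr]; congr 1
      apply store_ext hij <;> simp [Function.update_of_ne hij.symm, hti]
    | put =>
      have hr0 := hr
      simp only [run] at hr
      split_ifs at hr with hs
      by_cases ht : t j' = true
      · right; exact ⟨⟨W, rfl⟩, by simpa using hs, ht⟩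
      · left
        have : t = s := store_ext hij hti (by simp_all)
        rw [this] at hr0 ⊢; exact hr0

lemma split_free (i : Fin 2) (α : List (LSym 2)) : ∃ W rest, α = W ++ rest ∧
    (∀ x ∈ W, x.2 ≠ i) ∧ (rest = [] ∨ ∃ op r, rest = (op, i) :: r) := by
  induction α with
  | nil => exact ⟨[], [], rfl, by simp, Or.inl rfl⟩
  | cons x α ih =>
    by_cases hx : x.2 = i
    · exact ⟨[], x :: α, rfl, by simp, Or.inr ⟨x.1, α, by rw [← hx]⟩⟩
    · obtain ⟨W, rest, rfl, h1, h2⟩ := ih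
      refine ⟨x :: W, rest, rfl, ?_, h2⟩
      intro y hy
      rcases List.mem_cons.1 hy with rfl | hy
      · exact hx
      · exact h1 y hy

lemma split_rep (z : LSym 2) (α : List (LSym 2)) : ∃ m γ, α = List.replicate m z ++ γ ∧
    ∀ x r, γ = x :: r → x ≠ z := by
  induction α with
  | nil => exact ⟨0, [], rfl, by simp⟩
  | cons x α ih =>
    by_cases hx : x = z
    · obtain ⟨m, γ, rfl, h⟩ := ih
      exact ⟨m+1, γ, by simp [List.replicate_succ, hx], h⟩
    · refine ⟨0, x :: α, rfl, ?_⟩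
      intro y r h
      simp only [List.cons.injEq] at h
      rw [← h.1]; exact hx

lemma run_takes (i : Fin 2) (m : ℕ) : ∀ s : Store 2, s i = false →
    run (List.replicate m (LOp.take, i)) s = some s := by
  induction m with
  | zero => intro s h; simp [run]
  | succ m ih =>
    intro s h
    simp only [List.replicate_succ, run]
    rw [show Function.update s i false = s by rw [← h]; simp]
    exact ih s h

lemma trap2 {i j : Fin 2} (hij : j ≠ i) (β β' : List (LSym 2)) (hβ : β = (LOp.put, j) :: β')
    (s1 s2 : Store 2) (h1 : s1 i = true ∧ s1 j = false) (h2 : s2 i = false ∧ s2 j = true)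
    (hr : run β s1 = some s2) (F : Store 2) (hF : ∀ x, F x = true) (u : List (LSym 2)) :
    ∀ (n : ℕ) (Z : LProc 2), u.length ≤ n → (∃ x, (LOp.put, x) ∈ u) →
    (∀ z ∈ Z, PutHd z.1 ∧ z ≠ ([], true)) →
    ¬ LMustConv (replicate n ((LOp.put, i) :: β, false) +
      ((β, false) ::ₘ (u, true) ::ₘ Z), F) := by
  have hs2 : run [(LOp.put, i)] s2 = some F := by
    simp only [run, h2.1]
    simp only [Bool.false_eq_true, if_false, Option.some.injEq]
    apply store_ext hij <;> simp [hF, Function.update_of_ne hij, h2.2]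
  induction u with
  | nil => intro n Z _ h; simp at h
  | cons x u ih =>
    intro n Z hn hp hZ
    obtain ⟨op, y⟩ := x
    cases op with
    | put =>
      refine not_must .refl (dead ?_ ?_)
      · intro t ht
        apply blk_full hF
        simp only [mem_add, mem_cons] at ht
        rcases ht with ht | rfl | rfl | ht
        · rw [eq_of_mem_replicate ht]; exact putHd_cons _ _
        · rw [hβ]; exact putHd_cons _ _
        · exact putHd_cons _ _
        · exact (hZ t ht).1
      · intro ht
        simp only [mem_add, mem_cons] at ht
        rcases ht with ht | ht | ht | ht
        · simpa using eq_of_mem_replicate ht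
        · simp at ht
        · simp at ht
        · exact (hZ _ ht).2 rfl
    | take =>
      obtain ⟨m, rfl⟩ : ∃ m, n = m + 1 := ⟨n - 1, by simp at hn; omega⟩
      have hp' : ∃ x, (LOp.put, x) ∈ u := by simpa using hp
      have hy : y = i ∨ y = j := by omega
      rcases hy with rfl | rfl
      · have e1 : run [(LOp.take, y)] F = some s2 := by
          simp only [run, Option.some.injEq]
          apply store_ext hij <;> simp [hF, Function.update_of_ne hij, h2]
        refine not_must_trans (Y := (replicate m ((LOp.put, y) :: β, false) +
          ((β, false) ::ₘ (u, true) ::ₘ ((β, false) ::ₘ Z)), F)) ?_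
          (ih m _ (by simp at hn; omega) hp' ?_)
        · refine ReflTransGen.trans (reach_run' (u := u) (b := true)
            (R := replicate (m+1) ((LOp.put, y) :: β, false) + ((β, false) ::ₘ Z)) e1 ?_ rfl)
            (reach_run' (u := β) (b := false) (R := replicate m ((LOp.put, y) :: β, false) +
              ((β, false) ::ₘ (u, true) ::ₘ Z)) hs2 ?_ ?_)
          all_goals simp only [← singleton_add, replicate_succ, List.cons_append, List.nil_append]
          all_goals abel
        · intro z hz
          rcases mem_cons.1 hz with rfl | hz
          · exact ⟨by rw [hβ]; exact putHd_cons _ _, by simp⟩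
          · exact hZ z hz
      · have e1 : run [(LOp.take, y)] F = some s1 := by
          simp only [run, Option.some.injEq]
          apply store_ext hij <;> simp [hF, Function.update_of_ne hij.symm, h1]
        refine not_must_trans (Y := (replicate m ((LOp.put, i) :: β, false) +
          ((β, false) ::ₘ (u, true) ::ₘ (([], false) ::ₘ Z)), F)) ?_
          (ih m _ (by simp at hn; omega) hp' ?_)
        · refine ReflTransGen.trans (reach_run' (u := u) (b := true)
            (R := replicate (m+1) ((LOp.put, i) :: β, false) + ((β, false) ::ₘ Z)) e1 ?_ rfl)
            ((reach_run' (u := []) (b := false) (R := replicate (m+1) ((LOp.put, i) :: β, false) +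
              ((u, true) ::ₘ Z)) hr ?_ rfl).trans
            (reach_run' (u := β) (b := false) (R := replicate m ((LOp.put, i) :: β, false) +
              (([], false) ::ₘ (u, true) ::ₘ Z)) hs2 ?_ ?_))
          all_goals simp only [← singleton_add, replicate_succ, List.cons_append, List.nil_append,
            List.append_nil]
          all_goals abel
        · intro z hz
          rcases mem_cons.1 hz with rfl | hz
          · exact ⟨putHd_nil, by simp⟩
          · exact hZ z hz

end two

section lemS
open Multiset
variable {IS : Store 2} {A B : List (LSym 2)}

lemma pw_add (B : List (LSym 2)) (a b : ℕ) : (List.replicate (a+b) B).flatten =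
    (List.replicate a B).flatten ++ (List.replicate b B).flatten := by
  rw [List.replicate_add, List.flatten_append]

lemma pw_succ (B : List (LSym 2)) (a : ℕ) : (List.replicate (a+1) B).flatten =
    B ++ (List.replicate a B).flatten := by
  rw [List.replicate_succ, List.flatten_cons]

lemma exists_K (B : List (LSym 2)) : ∃ K, ∀ s, run (List.replicate K B).flatten s ≠ none →
    ∀ m, run (List.replicate m B).flatten s ≠ none := by
  have h : ∀ s : Store 2, ∃ K, run (List.replicate K B).flatten s ≠ none →
    ∀ m, run (List.replicate m B).flatten s ≠ none := by
    intro s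
    by_cases h : ∀ m, run (List.replicate m B).flatten s ≠ none
    · exact ⟨0, fun _ => h⟩
    · push Not at h
      obtain ⟨m, hm⟩ := h
      exact ⟨m, fun h' => absurd hm h'⟩
  choose K hK using h
  refine ⟨∑ s, K s, fun s hs => hK s ?_⟩
  have hle : K s ≤ ∑ s, K s := Finset.single_le_sum (f := K) (by simp) (Finset.mem_univ s)
  obtain ⟨d, hd⟩ := Nat.exists_eq_add_of_le hle
  rw [hd, pw_add, run_append] at hs
  intro h; rw [h] at hs; simp at hs

lemma lemS (F : Facts IS A B) (h : ∀ n, ∃ b s, BulkAt IS A B [] (n+1) b s) : False := by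
  obtain ⟨K, hK⟩ := exists_K B
  obtain ⟨b, s, -, hb⟩ := h K
  have h3 := F.f3 (K+1)
  rw [pw_succ] at h3
  have r1 := hb false true (List.replicate K B).flatten 0
  cases hr : run (b ++ (List.replicate K B).flatten) s with
  | none =>
    obtain ⟨w1, i, w2, t, he, h1, h2⟩ := run_none hr
    refine not_must (r1.trans (reach_run' (b := true) (u := (LOp.put, i) :: w2) h1
      (replicate (K+1) ([], false)) (by rw [he, add_cons, add_zero]) rfl)) (dead ?_ ?_) h3
    · intro x hx
      rcases mem_cons.1 hx with rfl | hx
      · exact blk_put h2 _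
      · rw [eq_of_mem_replicate hx]; exact blk_nil _
    · intro hx
      rcases mem_cons.1 hx with hx | hx
      · simp at hx
      · simpa using eq_of_mem_replicate hx
  | some t =>
    rw [run_append] at hr
    cases hb0 : run b s with
    | none => rw [hb0] at hr; simp at hr
    | some s0 =>
      rw [hb0] at hr; simp only [Option.bind_some] at hr
      have := hK s0 (by rw [hr]; simp) (K+1)
      obtain ⟨t', ht'⟩ := Option.ne_none_iff_exists'.1 this
      have hrun : run (b ++ (List.replicate (K+1) B).flatten) s = some t' := by
        rw [run_append, hb0]; simpa using ht'
      apply F.f3n (K+1)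
      rw [pw_succ]
      refine ⟨_, (hb false true _ 0).trans (reach_run' (b := true) (u := []) hrun
        (replicate (K+1) ([], false)) (by rw [add_cons, add_zero, List.append_nil]) rfl), ?_⟩
      simp [LSuccessful]

lemma run_put {i : Fin 2} {s : Store 2} (h : s i = false) :
    run [(LOp.put, i)] s = some (Function.update s i true) := by
  simp [run, h]

lemma exists_put (F : Facts IS A B) : ∃ x, (LOp.put, x) ∈ B := by
  by_contra h
  push Not at h
  cases hr : run B IS with
  | none =>
    obtain ⟨w1, i, w2, t, he, -⟩ := run_none hr
    exact h i (by rw [he]; simp)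
  | some t =>
    apply F.f3n 0
    refine ⟨_, reach_run' (b := true) (u := []) hr 0 (by simp) rfl, ?_⟩
    simp [LSuccessful]

/-- A put-put section without `T_i` in between is impossible. -/
lemma no_pp (F : Facts IS A B) {α' b : List (LSym 2)} {i : Fin 2} {s : Store 2}
    (h0 : cnt i α' = 0) (hp : (LOp.put, i) ∈ α')
    (h : BulkAt IS A B ((LOp.put, i) :: α') (B.length + 1) b s) : False := by
  have r := h.2 true false [] 0
  simp only [List.append_nil] at r
  refine not_must_trans r ?_ (F.f1 B.length)
  refine trap i α' true h0 (fun _ => hp) _ _ _ _ le_rfl ?_ ?_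
  · have := cnt_le i b
    have := h.1
    simp only [map_cons, map_zero, sum_cons, sum_zero]
    split_ifs <;> omega
  · intro r hr; simp at hr; rw [hr]; simp

lemma no_end (F : Facts IS A B) {α' b : List (LSym 2)} {i : Fin 2} {s : Store 2}
    (h0 : cnt i α' = 0) (hp : (LOp.put, i) ∈ B)
    (h : BulkAt IS A B ((LOp.put, i) :: α') (2 * B.length + 2) b s) : False := by
  have r := h.2 false false [] ((B, true) ::ₘ 0)
  simp only [List.append_nil] at r
  refine not_must_trans r ?_ (F.f2 (2 * B.length))
  refine trap i α' false h0 (by simp) _ _ _ _ le_rfl ?_ ?_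
  · have := cnt_le i b
    have := cnt_le i B
    have := h.1
    simp only [map_cons, map_zero, sum_cons, sum_zero]
    split_ifs <;> omega
  · intro r hr; simp at hr
    rcases hr with rfl | rfl
    · simp
    · simpa using hp

lemma upd_self {s : Store 2} {i : Fin 2} {a : Bool} (h : s i = a) : Function.update s i a = s := by
  rw [← h]; simp

theorem lemM (F : Facts IS A B) : ∀ N α, α.length ≤ N → (∃ pre, A = pre ++ α) →
    (∀ n, ∃ b s, BulkAt IS A B α (n+1) b s) →
    ∃ i, (LOp.put, i) ∉ B ∧ ∃ pre W, A = pre ++ (LOp.put, i) :: W ∧ ∀ x ∈ W, x.2 ≠ i := by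
  intro N
  induction N with
  | zero =>
    intro α hα _ h
    rw [Nat.le_zero, List.length_eq_zero_iff] at hα
    subst hα
    exact (lemS F h).elim
  | succ N ih =>
    intro α hα hpre h
    obtain ⟨pre, hA⟩ := hpre
    cases α with
    | nil => exact (lemS F h).elim
    | cons x α' =>
    obtain ⟨op, i⟩ := x
    simp only [List.length_cons] at hα
    cases op with
    | take =>
      refine ih α' (by omega) ⟨pre ++ [(LOp.take, i)], by simp [hA]⟩ fun n => ?_
      obtain ⟨b, s, hb⟩ := h n
      exact ⟨b, _, bulk_adv (w := [(LOp.take, i)]) hb rfl (by simp [run])⟩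
    | put =>
      obtain ⟨j, hij⟩ : ∃ j : Fin 2, j ≠ i := ⟨1 - i, by omega⟩
      have hN : ∀ n, ∃ b s, BulkAt IS A B ((LOp.put, i) :: α') (n+1) b s ∧ Blk s b ∧
          s i = false := by
        intro n
        obtain ⟨b, s, hb⟩ := h n
        obtain ⟨b, s, hb, hbl⟩ := bulk_norm hb
        refine ⟨b, s, hb, hbl, ?_⟩
        by_contra hs
        have hs : s i = true := by simpa using hs
        have r := hb.2 true false [] 0
        simp only [List.append_nil] at r
        refine not_must r (dead ?_ ?_) (F.f1 n)
        · intro t ht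
          simp only [mem_add, mem_cons, notMem_zero, or_false] at ht
          rcases ht with ht | rfl
          · rw [eq_of_mem_replicate ht]; exact blk_put hs _
          · exact hbl
        · intro ht
          simp only [mem_add, mem_cons, notMem_zero, or_false] at ht
          rcases ht with ht | ht
          · simpa using eq_of_mem_replicate ht
          · simp at ht
      obtain ⟨W, rest, rfl, hW, hrest⟩ := split_free i α'
      rcases hrest with rfl | ⟨op, r, rfl⟩
      · refine ⟨i, ?_, pre, W, by simpa using hA, hW⟩
        intro hp
        obtain ⟨b, s, hb⟩ := h (2 * B.length + 1)
        exact no_end F (by rw [cnt_free hW]; rfl) hp hb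
      · cases op with
        | put =>
          obtain ⟨b, s, hb⟩ := h B.length
          exact (no_pp F (by rw [cnt_free hW]; simp [cnt]) (by simp) hb).elim
        | take =>
          have hN2 : ∀ n, ∃ b s t, BulkAt IS A B ((LOp.put, i) :: (W ++ (LOp.take, i) :: r))
              (n+1) b s ∧ Blk s b ∧ s i = false ∧
              run W (Function.update s i true) = some t := by
            intro n
            obtain ⟨b, s, hb, hbl, hs⟩ := hN n
            cases hr : run W (Function.update s i true) with
            | some t => exact ⟨b, s, t, hb, hbl, hs, hr⟩
            | none =>
              exfalso
              obtain ⟨w1, x, w2, t, he, h1, h2⟩ := run_none hr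
              have hx : x ≠ i := hW (LOp.put, x) (by rw [he]; simp)
              have hti : t i = true := by
                rw [run_free (fun y hy => hW y (by rw [he]; simp [hy])) h1]; simp
              have hrr : run ((LOp.put, i) :: w1) s = some t := by simp [run, hs, h1]
              have hfull := all_full hx hti h2
              have r1 := hb.2 true false [] 0
              simp only [List.append_nil] at r1
              refine not_must (r1.trans (reach_run' (b := true)
                (u := (LOp.put, x) :: (w2 ++ (LOp.take, i) :: r)) hrr
                (replicate n ((LOp.put, i) :: (W ++ (LOp.take, i) :: r), true) + ((b, false) ::ₘ 0))
                ?_ rfl)) (dead ?_ ?_) (F.f1 n)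
              · rw [replicate_succ, cons_add]; congr 2; rw [he]; simp
              · intro y hy
                apply blk_full hfull
                simp only [mem_add, mem_cons, notMem_zero, or_false] at hy
                rcases hy with rfl | hy | rfl
                · exact putHd_cons _ _
                · rw [eq_of_mem_replicate hy]; exact putHd_cons _ _
                · exact hbl.putHd
              · intro hy
                simp only [mem_add, mem_cons, notMem_zero, or_false] at hy
                rcases hy with hy | hy | hy
                · simp at hy
                · simpa using eq_of_mem_replicate hy
                · simp at hy
          by_cases hC : ∀ n, ∃ b s t, BulkAt IS A B ((LOp.put, i) :: (W ++ (LOp.take, i) :: r))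
              (n+1) b s ∧ s i = false ∧ run W (Function.update s i true) = some t ∧
              run W t = some t
          · refine ih r (by simp at hα; omega)
              ⟨pre ++ (LOp.put, i) :: (W ++ [(LOp.take, i)]), by simp [hA]⟩ fun n => ?_
            obtain ⟨b, s, t, hb, hs, h1, h2⟩ := hC n
            have ht : t i = true := by rw [run_free hW h1]; simp
            refine ⟨b, Function.update t i false, bulk_adv
              (w := (LOp.put, i) :: (W ++ [(LOp.take, i)])) (s := s) (by simpa using hb) ?_ ?_⟩
            · simp [run, hs, run_append, h1]
            · simp [run, run_append, upd_self ht, h2]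
          · push Not at hC
            obtain ⟨n0, hn0⟩ := hC
            obtain ⟨b, s, t, hb, hbl, hs, hr⟩ := hN2 n0
            obtain ⟨⟨W', rfl⟩, hsj, htj⟩ :=
              (idem hij hW hr).resolve_left (hn0 b s t hb hs hr)
            rw [Function.update_of_ne hij] at hsj
            have hti : t i = true := by rw [run_free hW hr]; simp
            have hfull := all_full hij hti htj
            set E : Store 2 := s with hE
            have hall : ∀ n, BulkAt IS A B
                ((LOp.put, i) :: ((LOp.put, j) :: W' ++ (LOp.take, i) :: r)) (n+1) [] E := by
              intro n
              obtain ⟨b', s', t', hb', hbl', hs', hr'⟩ := hN2 n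
              have hsj' : s' j = false := by
                simp only [run, Function.update_of_ne hij] at hr'
                split_ifs at hr' with h
                simpa using h
              have : s' = E := store_ext hij (by rw [hs', hs]) (by rw [hsj', hsj])
              subst this
              have : b' = [] := by
                cases b' with
                | nil => rfl
                | cons x v =>
                  have h2 := (hbl' x v rfl).2
                  have : x.2 = i ∨ x.2 = j := by omega
                  rcases this with h | h <;> rw [h] at h2 <;> simp_all
              rw [this] at hb'; exact hb'
            obtain ⟨m, γ, rfl, hγ⟩ := split_rep (LOp.take, i) r
            have hrun : run ((LOp.put, i) :: ((LOp.put, j) :: W' ++ (LOp.take, i) ::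
                List.replicate m (LOp.take, i))) E = some (Function.update t i false) := by
              have h2 := run_takes i m (Function.update t i false) (by simp)
              rw [show ((LOp.put, i) :: ((LOp.put, j) :: W' ++ (LOp.take, i) ::
                List.replicate m (LOp.take, i))) = [(LOp.put, i)] ++ (((LOp.put, j) :: W') ++
                ([(LOp.take, i)] ++ List.replicate m (LOp.take, i))) by simp]
              rw [run_append, run_put hs, Option.bind_some, run_append, hr, Option.bind_some,
                run_append]
              simpa [run] using h2
            have hE2 : run [(LOp.put, i)] (Function.update t i false) = some t := by
              rw [run_put (by simp)]; simp [upd_self hti]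
            cases γ with
            | nil =>
              exfalso
              have hr2 : run ((LOp.put, j) :: W' ++ (LOp.take, i) ::
                  List.replicate m (LOp.take, i)) (Function.update E i true) =
                  some (Function.update t i false) := by
                rw [← hrun]; conv_rhs => rw [run]
                simp [hs]
              have r1 := (hall (B.length + 1)).2 false false [] ((B, true) ::ₘ 0)
              simp only [List.append_nil] at r1
              refine not_must_trans r1 ?_ (F.f2 B.length)
              refine not_must_trans (?_ : Reach _ (replicate B.length ((LOp.put, i) ::
                ((LOp.put, j) :: W' ++ (LOp.take, i) :: List.replicate m (LOp.take, i)), false) +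
                ((((LOp.put, j) :: W' ++ (LOp.take, i) :: List.replicate m (LOp.take, i)), false)
                ::ₘ (B, true) ::ₘ (([], false) ::ₘ ([], false) ::ₘ 0)), t))
                (trap2 hij _ _ rfl _ _ ?_ ?_ hr2 t hfull B _ _ le_rfl (exists_put F) ?_)
              · refine ReflTransGen.trans (reach_run' (u := []) (b := false)
                  (R := replicate (B.length+1) ((LOp.put, i) ::
                  ((LOp.put, j) :: W' ++ (LOp.take, i) :: List.replicate m (LOp.take, i)), false) +
                  (([], false) ::ₘ (B, true) ::ₘ 0)) hrun ?_ rfl)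
                  (reach_run' (u := ((LOp.put, j) :: W' ++ (LOp.take, i) ::
                    List.replicate m (LOp.take, i))) (b := false) (R := replicate B.length
                    ((LOp.put, i) :: ((LOp.put, j) :: W' ++ (LOp.take, i) ::
                      List.replicate m (LOp.take, i)), false) +
                    (([], false) ::ₘ ([], false) ::ₘ (B, true) ::ₘ 0)) hE2 ?_ ?_)
                all_goals simp only [← singleton_add, replicate_succ, List.cons_append,
                  List.nil_append, List.append_nil]
                all_goals abel
              · simp [Function.update_of_ne hij, hsj]
              · simp [Function.update_of_ne hij, htj]
              · intro z hz
                simp at hz; rw [hz]; exact ⟨putHd_nil, by simp⟩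
            | cons y γ =>
              obtain ⟨op, y⟩ := y
              cases op with
              | put =>
                exfalso
                have r1 := (hall 1).2 true false [] 0
                simp only [List.append_nil] at r1
                refine not_must (r1.trans (ReflTransGen.trans
                  (reach_run' (u := (LOp.put, y) :: γ) (b := true)
                  (R := replicate 1 ((LOp.put, i) :: ((LOp.put, j) :: W' ++ (LOp.take, i) ::
                  (List.replicate m (LOp.take, i) ++ (LOp.put, y) :: γ)), true) +
                  (([], false) ::ₘ 0)) hrun ?_ rfl)
                  (reach_run' (u := ((LOp.put, j) :: W' ++ (LOp.take, i) ::
                  (List.replicate m (LOp.take, i) ++ (LOp.put, y) :: γ))) (b := true)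
                    (R := ((LOp.put, y) :: γ, true) ::ₘ ([], false) ::ₘ 0) hE2 ?_ rfl)))
                  (dead ?_ ?_) (F.f1 1)
                · simp only [← singleton_add, replicate_succ, List.cons_append,
                    List.nil_append, List.append_nil, List.append_assoc]
                  abel
                · simp only [← singleton_add, replicate_succ, List.cons_append,
                    List.nil_append, List.append_nil, List.append_assoc, replicate_zero]
                  abel
                · intro z hz
                  apply blk_full hfull
                  simp only [mem_cons, notMem_zero, or_false] at hz
                  rcases hz with rfl | rfl | rfl
                  · exact putHd_cons _ _
                  · exact putHd_cons _ _
                  · exact putHd_nil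
                · simp
              | take =>
                have hy : y = j := by
                  have := hγ _ _ rfl
                  have : y ≠ i := by rintro rfl; exact this rfl
                  omega
                subst hy
                have hrun2 : run (((LOp.put, i) :: ((LOp.put, y) :: W' ++ (LOp.take, i) ::
                    List.replicate m (LOp.take, i))) ++ [(LOp.take, y)]) E = some E := by
                  rw [run_append, hrun]
                  simp only [Option.bind_some, run, Option.some.injEq]
                  apply store_ext hij <;> simp [Function.update_of_ne hij.symm, hs, hsj]
                refine ih γ (by simp at hα; omega) ⟨pre ++ (((LOp.put, i) :: ((LOp.put, y) :: W' ++
                  (LOp.take, i) :: List.replicate m (LOp.take, i))) ++ [(LOp.take, y)]),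
                  by simp [hA]⟩ fun n => ?_
                refine ⟨[], E, bulk_adv (s := E) ?_ hrun2 hrun2⟩
                simpa using hall n

end lemS

section fin
open Multiset
variable {IS : Store 2} {A B : List (LSym 2)}

lemma run_tk {W : List (LSym 2)} (h : ∀ x, (LOp.put, x) ∉ W) (s) : ∃ t, run W s = some t := by
  cases hr : run W s with
  | some t => exact ⟨t, rfl⟩
  | none =>
    obtain ⟨w1, i, w2, t, he, -⟩ := run_none hr
    exact (h i (by rw [he]; simp)).elim

theorem lemL (F : Facts IS A B) {i j : Fin 2} (hij : j ≠ i) (hA : (LOp.put, j) ∉ A) :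
    ∀ N α, α.length ≤ N → (∃ pre, A = pre ++ α) →
    (∀ n, ∃ b s, BulkAt IS A B α (n+1) b s ∧ s i = false) →
    ∀ s : Store 2, s i = false → ∃ t, run α s = some t := by
  intro N
  induction N with
  | zero =>
    intro α hα _ _ s _
    rw [Nat.le_zero, List.length_eq_zero_iff] at hα
    subst hα
    exact ⟨s, rfl⟩
  | succ N ih =>
    intro α hα hpre h s hs
    obtain ⟨pre, hpA⟩ := hpre
    cases α with
    | nil => exact ⟨s, rfl⟩
    | cons x α' =>
    obtain ⟨op, y⟩ := x
    simp only [List.length_cons] at hα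
    have hupd : ∀ (s : Store 2) y, s i = false → Function.update s y false i = false := by
      intro s y hs; rw [Function.update_apply]; split_ifs <;> simp [hs]
    cases op with
    | take =>
      have := ih α' (by omega) ⟨pre ++ [(LOp.take, y)], by simp [hpA]⟩ (fun n => by
        obtain ⟨b, s, hb, hs⟩ := h n
        exact ⟨b, _, bulk_adv (w := [(LOp.take, y)]) hb rfl (by simp [run]), hupd s y hs⟩)
      obtain ⟨t, ht⟩ := this (Function.update s y false) (hupd s y hs)
      exact ⟨t, by simpa [run] using ht⟩
    | put =>
      have hy : y = i := by
        have : y ≠ j := by rintro rfl; exact hA (by rw [hpA]; simp)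
        omega
      subst hy
      obtain ⟨W, rest, rfl, hW, hrest⟩ := split_free y α'
      have hWp : ∀ x, (LOp.put, x) ∉ W := by
        intro x hx
        have h1 : x ≠ y := hW _ hx
        have : x = j := by omega
        subst this
        exact hA (by rw [hpA]; simp [hx])
      have hsec : ∀ s : Store 2, s y = false → ∃ t, run ((LOp.put, y) :: W) s = some t ∧
          run W t = some t ∧ t y = true := by
        intro s hs
        obtain ⟨t, ht⟩ := run_tk hWp (Function.update s y true)
        refine ⟨t, by simp [run, hs, ht], ?_, by rw [run_free hW ht]; simp⟩
        rcases idem hij hW ht with h | ⟨⟨W', rfl⟩, -⟩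
        · exact h
        · exact (hWp j (by simp)).elim
      rcases hrest with rfl | ⟨op, r, rfl⟩
      · obtain ⟨t, ht, -⟩ := hsec s hs
        exact ⟨t, by simpa using ht⟩
      · cases op with
        | put =>
          obtain ⟨b, s, hb, -⟩ := h B.length
          exact (no_pp F (by rw [cnt_free hW]; simp [cnt]) (by simp) hb).elim
        | take =>
          have hsec2 : ∀ s : Store 2, s y = false → ∃ t,
              run ((LOp.put, y) :: (W ++ [(LOp.take, y)])) s = some t ∧
              run ((LOp.put, y) :: (W ++ [(LOp.take, y)])) t = some t ∧ t y = false := by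
            intro s hs
            obtain ⟨t, h1, h2, h3⟩ := hsec s hs
            refine ⟨Function.update t y false, ?_, ?_, by simp⟩
            · rw [show (LOp.put, y) :: (W ++ [(LOp.take, y)]) =
                ((LOp.put, y) :: W) ++ [(LOp.take, y)] by simp, run_append, h1]
              simp [run]
            · simp [run, run_append, upd_self h3, h2]
          have := ih r (by simp at hα; omega)
            ⟨pre ++ (LOp.put, y) :: (W ++ [(LOp.take, y)]), by simp [hpA]⟩ (fun n => by
              obtain ⟨b, s, hb, hs⟩ := h n
              obtain ⟨t, h1, h2, h3⟩ := hsec2 s hs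
              exact ⟨b, t, bulk_adv (w := (LOp.put, y) :: (W ++ [(LOp.take, y)])) (s := s)
                (by simpa using hb) h1 h2, h3⟩)
          obtain ⟨t, h1, h2, h3⟩ := hsec2 s hs
          obtain ⟨t', ht'⟩ := this t h3
          refine ⟨t', ?_⟩
          rw [show (LOp.put, y) :: (W ++ (LOp.take, y) :: r) =
            ((LOp.put, y) :: (W ++ [(LOp.take, y)])) ++ r by simp, run_append, h1]
          simpa using ht'

lemma no_solo (F : Facts IS B A) {t} (h : run A IS = some t) : False := by
  apply F.f3n 0
  refine ⟨_, reach_run' (b := true) (u := []) h 0 (by simp) rfl, ?_⟩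
  simp [LSuccessful]

lemma run_reps (j : Fin 2) (m : ℕ) : ∀ s : Store 2,
    run (List.replicate (m+1) (LOp.take, j)) s = some (Function.update s j false) := by
  intro s
  simp only [List.replicate_succ, run]
  exact run_takes _ _ _ (by simp)

lemma half (FA : Facts IS A B) (FB : Facts IS B A) {i j : Fin 2} (hij : j ≠ i)
    (hA : (LOp.put, j) ∉ A) (hB : (LOp.put, i) ∉ B) {pre W : List (LSym 2)}
    (hAW : A = pre ++ (LOp.put, i) :: W) (hW : ∀ x ∈ W, x.2 ≠ i)
    {A' : List (LSym 2)} (hA' : A = (LOp.take, j) :: A') : False := by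
  have hBrun : ∀ s : Store 2, s j = false → ∃ t, run B s = some t := by
    refine lemL FB hij.symm hB _ B le_rfl ⟨[], rfl⟩ fun n => ?_
    refine ⟨A', Function.update IS j false, ⟨by simp [hA'], fun c c' tl R => ?_⟩, by simp⟩
    refine reach_run' (w := [(LOp.take, j)]) (u := A' ++ tl) (b := c') (by simp [run])
      (replicate (n+1) (B, c) + R) ?_ ?_
    · rw [hA', add_cons]; rfl
    · rw [add_cons]
  obtain ⟨m, γ, hγ, hγ2⟩ := split_rep (LOp.take, j) A
  obtain ⟨a, rfl⟩ : ∃ a, m = a + 1 := by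
    cases m with
    | zero =>
      simp only [List.replicate_zero, List.nil_append] at hγ
      exact (hγ2 _ _ (hγ ▸ hA') rfl).elim
    | succ a => exact ⟨a, rfl⟩
  have hlast : ∃ pre', γ = pre' ++ (LOp.put, i) :: W := by
    rw [hγ] at hAW
    rcases List.append_eq_append_iff.1 hAW with ⟨a', h1, h2⟩ | ⟨c', h1, h2⟩
    · exact ⟨a', h2⟩
    · cases c' with
      | nil => exact ⟨[], by simpa using h2.symm⟩
      | cons x c' =>
        simp only [List.cons_append, List.cons.injEq] at h2
        have : (LOp.put, i) ∈ List.replicate (a+1) (LOp.take, j) := by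
          rw [h1, ← h2.1]; simp
        simp [List.mem_replicate] at this
  obtain ⟨pre', hγl⟩ := hlast
  cases γ with
  | nil => simp at hγl
  | cons x γ' =>
  obtain ⟨op, y⟩ := x
  have hy : op = LOp.put ∧ y = i := by
    cases op with
    | put =>
      have : y ≠ j := by rintro rfl; exact hA (by rw [hγ]; simp)
      exact ⟨rfl, by omega⟩
    | take =>
      exfalso
      have : y ≠ j := by rintro rfl; exact hγ2 _ _ rfl rfl
      have hyi : y = i := by omega
      subst hyi
      have hrun : ∀ s, run (List.replicate (a+1) (LOp.take, j) ++ [(LOp.take, y)]) s =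
          some (Function.update (Function.update s j false) y false) := by
        intro s; rw [run_append, run_reps]; simp [run]
      have hidem : ∀ s : Store 2, Function.update (Function.update
          (Function.update (Function.update s j false) y false) j false) y false =
          Function.update (Function.update s j false) y false := by
        intro s; apply store_ext hij <;> simp [Function.update_of_ne hij]
      have := lemL FA hij hA _ γ' le_rfl
        ⟨List.replicate (a+1) (LOp.take, j) ++ [(LOp.take, y)], by simp [hγ]⟩ (fun n =>
          ⟨B, _, bulk_adv (w := List.replicate (a+1) (LOp.take, j) ++ [(LOp.take, y)])
            (s := IS) (by have := bulk_start (IS := IS) (A := A) (B := B) (n+1)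
                          rw [hγ] at this ⊢; simpa using this)
            (hrun IS) (by rw [hrun, hidem]), by simp⟩)
        (Function.update (Function.update IS j false) y false) (by simp)
      obtain ⟨t, ht⟩ := this
      refine no_solo FB (t := t) ?_
      rw [hγ, show List.replicate (a+1) (LOp.take, j) ++ (LOp.take, y) :: γ' =
        (List.replicate (a+1) (LOp.take, j) ++ [(LOp.take, y)]) ++ γ' by simp, run_append, hrun]
      simpa using ht
  obtain ⟨rfl, rfl⟩ := hy
  obtain ⟨s1, hs1⟩ := hBrun (Function.update IS j false) (by simp)
  obtain ⟨s2, hs2⟩ := hBrun (Function.update s1 j false) (by simp)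
  obtain ⟨w1, w2, t, hw, hr, hbl⟩ := norm_run ((LOp.put, y) :: γ') s2
  have hty : t y = true := by
    cases w2 with
    | nil =>
      simp only [List.append_nil] at hw
      rw [← hw, hγl, run_append] at hr
      cases hp : run pre' s2 with
      | none => rw [hp] at hr; simp at hr
      | some s3 =>
        rw [hp] at hr
        simp only [Option.bind_some, run] at hr
        split_ifs at hr
        rw [run_free hW hr]; simp
    | cons x v =>
      obtain ⟨op, z⟩ := x
      obtain ⟨h1, h2⟩ := hbl _ _ rfl
      simp only at h1 h2
      subst h1
      have : z ≠ j := by rintro rfl; exact hA (by rw [hγ, hw]; simp)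
      have : z = y := by omega
      rw [← this]; exact h2
  refine not_must (Y := (((LOp.put, y) :: γ', true) ::ₘ (w2, false) ::ₘ ([], false) ::ₘ
    ([], false) ::ₘ 0, t)) ?_ (dead ?_ ?_) FA.f4
  · have R1 := reach_run' (b := true) (u := (LOp.put, y) :: γ') (run_reps j a IS)
      ((A, false) ::ₘ (B, false) ::ₘ (B, false) ::ₘ 0) rfl rfl
    have R2 := reach_run' (b := false) (u := []) hs1
      (((LOp.put, y) :: γ', true) ::ₘ (A, false) ::ₘ (B, false) ::ₘ 0) rfl rfl
    have R3 := reach_run' (b := false) (u := (LOp.put, y) :: γ') (run_reps j a s1)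
      (((LOp.put, y) :: γ', true) ::ₘ ([], false) ::ₘ (B, false) ::ₘ 0) rfl rfl
    have R4 := reach_run' (b := false) (u := []) hs2
      (((LOp.put, y) :: γ', true) ::ₘ ([], false) ::ₘ ((LOp.put, y) :: γ', false) ::ₘ 0) rfl rfl
    have R5 := reach_run' (b := false) (u := w2) hr
      (((LOp.put, y) :: γ', true) ::ₘ ([], false) ::ₘ ([], false) ::ₘ 0) rfl rfl
    rw [← hγ] at R1 R3
    rw [← hw] at R5
    refine (R1.trans ?_)
    convert R2.trans ?_ using 2
    · simp only [← singleton_add, List.append_nil]; abel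
    convert R3.trans ?_ using 2
    · simp only [← singleton_add]; abel
    convert R4.trans ?_ using 2
    · simp only [← singleton_add, List.append_nil]; abel
    convert R5 using 2
    · simp only [← singleton_add]; abel
    · simp only [← singleton_add]; abel
  · intro z hz
    simp only [mem_cons, notMem_zero, or_false] at hz
    rcases hz with rfl | rfl | rfl | rfl
    · exact blk_put hty _
    · exact hbl
    · exact blk_nil _
    · exact blk_nil _
  · simp

lemma head_cases (FA : Facts IS A B) (FB : Facts IS B A) {i j : Fin 2} (hij : j ≠ i)
    (hA : (LOp.put, j) ∉ A) (hA2 : (LOp.put, i) ∈ A) :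
    IS i = true ∧ ((∃ A', A = (LOp.take, j) :: A') ∨ (∃ A', A = (LOp.put, i) :: A')) := by
  constructor
  · by_contra h
    have h : IS i = false := by simpa using h
    obtain ⟨t, ht⟩ := lemL FA hij hA _ A le_rfl ⟨[], rfl⟩
      (fun n => ⟨B, IS, bulk_start _, h⟩) IS h
    exact no_solo FB ht
  · cases A with
    | nil => simp at hA2
    | cons x A' =>
      obtain ⟨op, y⟩ := x
      have hy : y = i ∨ y = j := by omega
      cases op with
      | take =>
        rcases hy with rfl | rfl
        · exfalso
          have := lemL FA hij hA _ A' le_rfl ⟨[(LOp.take, y)], rfl⟩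
            (fun n => ⟨B, _, bulk_adv (w := [(LOp.take, y)]) (s := IS) (bulk_start (n+1)) rfl
              (by simp [run]), by simp⟩) (Function.update IS y false) (by simp)
          obtain ⟨t, ht⟩ := this
          exact no_solo FB (t := t) (by simpa [run] using ht)
        · left; exact ⟨_, rfl⟩
      | put =>
        rcases hy with rfl | rfl
        · right; exact ⟨_, rfl⟩
        · simp at hA

theorem no_facts (FA : Facts IS A B) (FB : Facts IS B A) : False := by
  obtain ⟨i, hi, pre, W, hAW, hW⟩ := lemM FA _ A le_rfl ⟨[], rfl⟩
    (fun n => ⟨B, IS, bulk_start _⟩)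
  obtain ⟨j, hj, pre', V, hBV, hV⟩ := lemM FB _ B le_rfl ⟨[], rfl⟩
    (fun n => ⟨A, IS, bulk_start _⟩)
  have hiA : (LOp.put, i) ∈ A := by rw [hAW]; simp
  have hjB : (LOp.put, j) ∈ B := by rw [hBV]; simp
  have hij : j ≠ i := by rintro rfl; exact hj hiA
  obtain ⟨hISi, hAh⟩ := head_cases FA FB hij hj hiA
  obtain ⟨hISj, hBh⟩ := head_cases FB FA hij.symm hi hjB
  rcases hAh with ⟨A', hA'⟩ | ⟨A', hA'⟩
  · exact half FA FB hij hj hi hAW hW hA'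
  · rcases hBh with ⟨B', hB'⟩ | ⟨B', hB'⟩
    · exact half FB FA hij.symm hi hj hBV hV hB'
    · refine not_must .refl (dead ?_ ?_) (FA.f1 0)
      · intro z hz
        apply blk_full (all_full hij hISi hISj)
        simp at hz
        rcases hz with rfl | rfl
        · rw [hA']; exact putHd_cons _ _
        · rw [hB']; exact putHd_cons _ _
      · simp [hA']

end fin

section source
open Multiset

def swS : SSym → SSym
  | SSym.bang => SSym.ques
  | SSym.ques => SSym.bang

def swT (t : SSub) : SSub := (t.1.map swS, t.2)

def swP (P : SProc) : SProc := P.map swT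

lemma swS_swS (c : SSym) : swS (swS c) = c := by cases c <;> rfl

lemma swT_swT (t : SSub) : swT (swT t) = t := by
  obtain ⟨u, b⟩ := t
  have : swS ∘ swS = id := by funext c; exact swS_swS c
  simp [swT, this]

lemma swP_swP (P : SProc) : swP (swP P) = P := by
  simp [swP, Multiset.map_map, swT_swT]

lemma sw_step {P Q : SProc} (h : SysStep P Q) : SysStep (swP P) (swP Q) := by
  obtain ⟨u1, u2, b1, b2, R, rfl, rfl⟩ := h
  refine ⟨u2.map swS, u1.map swS, b2, b1, swP R, ?_, ?_⟩
  · simp only [swP, map_cons, swT, List.map_cons, swS]; rw [cons_swap]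
  · simp only [swP, map_cons, swT]; rw [cons_swap]

lemma sw_reach {P Q : SProc} (h : ReflTransGen SysStep P Q) :
    ReflTransGen SysStep (swP P) (swP Q) := by
  induction h with
  | refl => exact .refl
  | tail _ h ih => exact ih.tail (sw_step h)

lemma sw_may {P : SProc} (h : SMayConv P) : SMayConv (swP P) := by
  obtain ⟨Q, h1, h2⟩ := h
  exact ⟨swP Q, sw_reach h1, mem_map.2 ⟨_, h2, rfl⟩⟩

lemma sw_must {P : SProc} (h : SMustConv P) : SMustConv (swP P) := by
  intro Q hQ
  have := sw_may (h (swP Q) (by simpa [swP_swP] using sw_reach hQ))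
  rwa [swP_swP] at this

lemma trans_sw {k : ℕ} (A B : List (LSym k)) (P : SProc) :
    transProc B A P = transProc A B (swP P) := by
  simp only [transProc, swP, Multiset.map_map]
  apply map_congr rfl
  rintro ⟨u, b⟩ -
  simp only [transSub, swT, Function.comp, Prod.mk.injEq, and_true, List.flatMap_map]
  congr 1
  funext c
  cases c <;> rfl

lemma correct_swap {k : ℕ} {IS : Store k} {A B : List (LSym k)} (h : Correct IS A B) :
    Correct IS B A := by
  intro P
  rw [trans_sw, ← (h (swP P)).1, ← (h (swP P)).2]
  refine ⟨⟨sw_may, fun h => ?_⟩, ⟨sw_must, fun h => ?_⟩⟩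
  · simpa [swP_swP] using sw_may h
  · simpa [swP_swP] using sw_must h

def nb (P : SProc) : ℕ := (P.map fun t => t.1.count SSym.bang).sum
def nq (P : SProc) : ℕ := (P.map fun t => t.1.count SSym.ques).sum
def nt (P : SProc) : ℕ := (P.map fun t => if t.2 then 1 else 0).sum

lemma step_counts {P Q : SProc} (h : SysStep P Q) :
    nb P = nb Q + 1 ∧ nq P = nq Q + 1 ∧ nt P = nt Q := by
  obtain ⟨u1, u2, b1, b2, R, rfl, rfl⟩ := h
  simp [nb, nq, nt]
  omega

lemma not_may_inv {P : SProc} (h1 : nb P < nq P) (h2 : ∀ t ∈ P, t.2 = false → SSym.ques ∉ t.1)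
    (h3 : nt P ≤ 1) : ¬ SMayConv P := by
  rintro ⟨Q, hr, hs⟩
  induction hr using ReflTransGen.head_induction_on with
  | refl =>
    obtain ⟨R, rfl⟩ := exists_cons_of_mem hs
    simp only [nt, map_cons, sum_cons, if_true] at h3
    have hR : ∀ t ∈ R, t.2 = false := by
      intro t ht
      by_contra hb
      obtain ⟨R', rfl⟩ := exists_cons_of_mem ht
      simp [hb] at h3
    have : nq (([], true) ::ₘ R) = 0 := by
      simp only [nq, map_cons, sum_cons, List.count_nil, zero_add]
      apply sum_eq_zero
      intro x hx
      obtain ⟨t, ht, rfl⟩ := mem_map.1 hx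
      exact List.count_eq_zero.2 (h2 t (mem_cons_of_mem ht) (hR t ht))
    omega
  | head hst _ ih =>
    obtain ⟨e1, e2, e3⟩ := step_counts hst
    refine ih (by omega) ?_ (by omega)
    obtain ⟨u1, u2, b1, b2, R, rfl, rfl⟩ := hst
    intro t ht hb
    simp only [mem_cons] at ht h2
    rcases ht with rfl | rfl | ht
    · have := h2 _ (Or.inl rfl) hb; simp at this; exact this
    · have := h2 _ (Or.inr (Or.inl rfl)) hb; simp at this
    · exact h2 _ (Or.inr (Or.inr ht)) hb

def InvM (P : SProc) : Prop :=
  (∀ t ∈ P, SSym.bang ∉ t.1 ∨ (SSym.ques ∉ t.1 ∧ t.2 = false)) ∧ (∃ t ∈ P, t.2 = true) ∧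
    nq P ≤ nb P

lemma invM_step {P Q : SProc} (h : InvM P) (hst : SysStep P Q) : InvM Q := by
  obtain ⟨h1, h2, h3⟩ := h
  obtain ⟨e1, e2, e3⟩ := step_counts hst
  obtain ⟨u1, u2, b1, b2, R, rfl, rfl⟩ := hst
  refine ⟨?_, ?_, by omega⟩
  · intro t ht
    simp only [mem_cons] at ht h1
    rcases ht with rfl | rfl | ht
    · have := h1 _ (Or.inl rfl); simp at this; right; simpa using this
    · have := h1 _ (Or.inr (Or.inl rfl)); simp at this; left; simpa using this
    · exact h1 _ (Or.inr (Or.inr ht))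
  · obtain ⟨t, ht, hb⟩ := h2
    simp only [mem_cons] at ht
    rcases ht with rfl | rfl | ht
    · exact ⟨_, mem_cons_self _ _, hb⟩
    · exact ⟨(u2, b2), by simp, hb⟩
    · exact ⟨t, by simp [ht], hb⟩

lemma invM_may : ∀ N (P : SProc), nq P ≤ N → InvM P → SMayConv P := by
  intro N
  induction N with
  | zero =>
    intro P hN h
    obtain ⟨h1, ⟨⟨u, b⟩, ht, hb⟩, h3⟩ := h
    simp only at hb
    subst hb
    refine ⟨P, .refl, ?_⟩
    have hb : SSym.bang ∉ u := by simpa using h1 _ ht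
    have hq : SSym.ques ∉ u := by
      rw [← List.count_eq_zero]
      have := single_le_sum (s := P.map fun t => t.1.count SSym.ques) (by simp) _
        (mem_map_of_mem _ ht)
      simp only [nq] at hN
      simp only at this
      omega
    have : u = [] := by
      cases u with
      | nil => rfl
      | cons c u => cases c <;> simp at hb hq
    rw [this] at ht
    exact ht
  | succ N ih =>
    intro P hN h
    by_cases h0 : nq P = 0
    · exact ih P (by omega) h
    have hq : ∃ t ∈ P, SSym.ques ∈ t.1 := by
      by_contra hc
      push Not at hc
      apply h0
      apply sum_eq_zero
      intro x hx
      obtain ⟨t, ht, rfl⟩ := mem_map.1 hx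
      exact List.count_eq_zero.2 (hc t ht)
    have hb : ∃ t ∈ P, SSym.bang ∈ t.1 := by
      by_contra hc
      push Not at hc
      have : nb P = 0 := by
        apply sum_eq_zero
        intro x hx
        obtain ⟨t, ht, rfl⟩ := mem_map.1 hx
        exact List.count_eq_zero.2 (hc t ht)
      have := h.2.2
      omega
    obtain ⟨⟨u, b⟩, ht, hu⟩ := hq
    obtain ⟨⟨v, c⟩, ht', hv⟩ := hb
    have e1 : SSym.bang ∉ u := by
      rcases h.1 _ ht with h | h
      · exact h
      · exact (h.1 hu).elim
    have e2 : SSym.ques ∉ v := by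
      rcases h.1 _ ht' with h | h
      · exact (h hv).elim
      · exact h.1
    obtain ⟨u', rfl⟩ : ∃ u', u = SSym.ques :: u' := by
      cases u with
      | nil => simp at hu
      | cons c u => cases c with
        | bang => simp at e1
        | ques => exact ⟨_, rfl⟩
    obtain ⟨v', rfl⟩ : ∃ v', v = SSym.bang :: v' := by
      cases v with
      | nil => simp at hv
      | cons c u => cases c with
        | bang => exact ⟨_, rfl⟩
        | ques => simp at e2
    obtain ⟨P', rfl⟩ := exists_cons_of_mem ht'
    have ht2 : (SSym.ques :: u', b) ∈ P' := by simpa using ht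
    obtain ⟨R, rfl⟩ := exists_cons_of_mem ht2
    have hst : SysStep ((SSym.bang :: v', c) ::ₘ (SSym.ques :: u', b) ::ₘ R)
      ((v', c) ::ₘ (u', b) ::ₘ R) := ⟨_, _, _, _, _, rfl, rfl⟩
    obtain ⟨Q, hQ, hQ'⟩ := ih _ (by have := step_counts hst; omega) (invM_step h hst)
    exact ⟨Q, ReflTransGen.head hst hQ, hQ'⟩

lemma must_inv {P : SProc} (h : InvM P) : SMustConv P := by
  intro Q hQ
  apply invM_may _ _ le_rfl
  induction hQ with
  | refl => exact h
  | tail _ hst ih => exact invM_step ih hst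

lemma succ_step {P Q : SProc} (h : SSuccessful P) (hst : SysStep P Q) : SSuccessful Q := by
  obtain ⟨u1, u2, b1, b2, R, rfl, rfl⟩ := hst
  simp [SSuccessful] at h ⊢
  tauto

lemma src1 (n : ℕ) :
    SMustConv (replicate (n+1) ([SSym.bang], true) + (([SSym.ques], false) ::ₘ 0)) := by
  intro Q hQ
  have key : SSuccessful Q ∨
      Q = replicate (n+1) ([SSym.bang], true) + (([SSym.ques], false) ::ₘ 0) := by
    induction hQ with
    | refl => right; rfl
    | tail _ hst ih =>
      left
      rcases ih with h | h
      · exact succ_step h hst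
      · obtain ⟨u1, u2, b1, b2, R, h1, rfl⟩ := hst
        have : (SSym.bang :: u1, b1) ∈
            replicate (n+1) ([SSym.bang], true) + (([SSym.ques], false) ::ₘ 0) := by
          rw [← h, h1]; simp
        simp only [mem_add, mem_cons, notMem_zero, or_false] at this
        rcases this with h | h
        · have := eq_of_mem_replicate h
          simp at this
          simp [SSuccessful, this]
        · simp at h
  rcases key with h | rfl
  · exact ⟨Q, .refl, h⟩
  · refine ⟨([], true) ::ₘ ([], false) ::ₘ replicate n ([SSym.bang], true), .single
      ⟨[], [], true, false, replicate n ([SSym.bang], true), ?_, rfl⟩, by simp [SSuccessful]⟩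
    simp only [replicate_succ, ← singleton_add]; abel

lemma half_facts {IS : Store 2} {A B : List (LSym 2)} (h : Correct IS A B) : Facts IS A B where
  f1 n := by
    have := (h _).2.1 (src1 n)
    simpa [transProc, transSub] using this
  f2 n := by
    have := (h (replicate (n+2) ([SSym.bang], false) +
      (([SSym.ques], false) ::ₘ ([SSym.ques], true) ::ₘ 0))).2.1 (must_inv ⟨?_, ?_, ?_⟩)
    · simpa [transProc, transSub] using this
    · intro t ht
      simp only [mem_add, mem_cons, notMem_zero, or_false] at ht
      rcases ht with ht | rfl | rfl
      · rw [eq_of_mem_replicate ht]; simp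
      · simp
      · simp
    · exact ⟨([SSym.ques], true), by simp, rfl⟩
    · simp [nb, nq]; omega
  f3 n := by
    have := (h (replicate n ([SSym.bang], false) +
      ((List.replicate n SSym.ques, true) ::ₘ 0))).2.1 (must_inv ⟨?_, ?_, ?_⟩)
    · simpa [transProc, transSub, List.flatMap_def] using this
    · intro t ht
      simp only [mem_add, mem_cons, notMem_zero, or_false] at ht
      rcases ht with ht | rfl
      · rw [eq_of_mem_replicate ht]; simp
      · simp
    · exact ⟨(List.replicate n SSym.ques, true), by simp, rfl⟩
    · simp [nb, nq]
  f3n n := by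
    have := mt (h (replicate n ([SSym.bang], false) +
      ((List.replicate (n+1) SSym.ques, true) ::ₘ 0))).1.2 (not_may_inv ?_ ?_ ?_)
    · simpa [transProc, transSub, List.flatMap_def] using this
    · simp [nb, nq, List.count_replicate]
    · intro t ht
      simp only [mem_add, mem_cons, notMem_zero, or_false] at ht
      rcases ht with ht | rfl
      · rw [eq_of_mem_replicate ht]; simp
      · simp
    · simp [nt]
  f4 := by
    have := (correct_swap h (([SSym.ques], true) ::ₘ ([SSym.ques], false) ::ₘ
      ([SSym.bang], false) ::ₘ ([SSym.bang], false) ::ₘ 0)).2.1 (must_inv ⟨?_, ?_, ?_⟩)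
    · simpa [transProc, transSub] using this
    · intro t ht
      simp only [mem_cons, notMem_zero, or_false] at ht
      rcases ht with rfl | rfl | rfl | rfl <;> simp
    · exact ⟨([SSym.ques], true), by simp, rfl⟩
    · simp [nb, nq]

theorem part_one (IS : Store 2) (A B : List (LSym 2)) : ¬ Correct IS A B :=
  fun h => no_facts (half_facts h) (half_facts (correct_swap h))

end source

section three
open Multiset

abbrev ts (u : List SSym) : List (LSym 3) := (transSub tb3 tq3 (u, false)).1
abbrev tr (P : SProc) : LProc 3 := transProc tb3 tq3 P

lemma transSub_eq (u : List SSym) (b : Bool) : transSub tb3 tq3 (u, b) = (ts u, b) := rfl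

lemma ts_nil : ts [] = [] := rfl

lemma ts_bang (u) : ts (SSym.bang :: u) =
    (LOp.put, 0) :: (LOp.take, 2) :: (LOp.put, 1) :: (LOp.take, 0) :: ts u := rfl

lemma ts_ques (u) : ts (SSym.ques :: u) = (LOp.put, 2) :: (LOp.take, 1) :: ts u := rfl

lemma tr_cons (u b P) : tr ((u, b) ::ₘ P) = (ts u, b) ::ₘ tr P := by
  simp [tr, transProc, transSub_eq]

lemma tr_succ {P : SProc} : (([], true) : LSub 3) ∈ tr P ↔ SSuccessful P := by
  constructor
  · intro h
    obtain ⟨⟨u, b⟩, hu, he⟩ := mem_map.1 h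
    rw [transSub_eq, Prod.mk.injEq] at he
    obtain ⟨h1, rfl⟩ := he
    cases u with
    | nil => exact hu
    | cons c u => cases c <;> simp [ts_bang, ts_ques] at h1
  · intro h
    exact mem_map.2 ⟨_, h, rfl⟩

abbrev sIS : Store 3 := ![false, true, true]
abbrev sFFF : Store 3 := ![true, true, true]
abbrev sFFE : Store 3 := ![true, true, false]
abbrev sFEF : Store 3 := ![true, false, true]

lemma u1 : Function.update sIS 0 true = sFFF := by decide
lemma u2 : Function.update sFFF 2 false = sFFE := by decide
lemma u3 : Function.update sFFE 2 true = sFFF := by decide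
lemma u4 : Function.update sFFF 1 false = sFEF := by decide
lemma u5 : Function.update sFEF 1 true = sFFF := by decide
lemma u6 : Function.update sFFF 0 false = sIS := by decide

inductive Rel : LProc 3 × Store 3 → SProc → Prop
  | r0 (P) : Rel (tr P, sIS) P
  | r1 (u b P) : Rel (((LOp.take, 2) :: (LOp.put, 1) :: (LOp.take, 0) :: ts u, b) ::ₘ tr P, sFFF)
      ((SSym.bang :: u, b) ::ₘ P)
  | r2 (u b P) : Rel (((LOp.put, 1) :: (LOp.take, 0) :: ts u, b) ::ₘ tr P, sFFE)
      ((SSym.bang :: u, b) ::ₘ P)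
  | r3 (u b v b' P) : Rel (((LOp.put, 1) :: (LOp.take, 0) :: ts u, b) ::ₘ
      ((LOp.take, 1) :: ts v, b') ::ₘ tr P, sFFF)
      ((SSym.bang :: u, b) ::ₘ (SSym.ques :: v, b') ::ₘ P)
  | r4 (u b P) : Rel (((LOp.put, 1) :: (LOp.take, 0) :: ts u, b) ::ₘ tr P, sFEF)
      ((u, b) ::ₘ P)
  | r5 (u b P) : Rel (((LOp.take, 0) :: ts u, b) ::ₘ tr P, sFFF) ((u, b) ::ₘ P)

lemma inv1 {a : LSub 3} {M : LProc 3} {s : Store 3} {Y} (h : LockStep (a ::ₘ M, s) Y) :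
    (∃ i w, a = ((LOp.put, i) :: w, a.2) ∧ s i = false ∧
      Y = ((w, a.2) ::ₘ M, Function.update s i true)) ∨
    (∃ i w, a = ((LOp.take, i) :: w, a.2) ∧ Y = ((w, a.2) ::ₘ M, Function.update s i false)) ∨
    (∃ M' s', LockStep (M, s) (M', s') ∧ Y = (a ::ₘ M', s')) := by
  obtain ⟨Y1, Y2⟩ := Y
  obtain ⟨i, u, b, R, ⟨h1, h2, h3, h4⟩ | ⟨h1, h3, h4⟩⟩ := h
  · simp only at h1 h2 h3 h4
    subst h3 h4
    rcases cons_eq_cons.1 h1 with ⟨rfl, rfl⟩ | ⟨-, R', rfl, rfl⟩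
    · left; exact ⟨i, u, rfl, h2, rfl⟩
    · right; right
      exact ⟨_, _, step_put i u b R' s h2, by rw [cons_swap]⟩
  · simp only at h1 h3 h4
    subst h3 h4
    rcases cons_eq_cons.1 h1 with ⟨rfl, rfl⟩ | ⟨-, R', rfl, rfl⟩
    · right; left; exact ⟨i, u, rfl, rfl⟩
    · right; right
      exact ⟨_, _, step_take i u b R' s, by rw [cons_swap]⟩

lemma tr_inv {P : SProc} {x w c R} (h : tr P = (x :: w, c) ::ₘ R) :
    (∃ u P', P = (SSym.bang :: u, c) ::ₘ P' ∧ x = (LOp.put, 0) ∧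
      w = (LOp.take, 2) :: (LOp.put, 1) :: (LOp.take, 0) :: ts u ∧ R = tr P') ∨
    (∃ u P', P = (SSym.ques :: u, c) ::ₘ P' ∧ x = (LOp.put, 2) ∧
      w = (LOp.take, 1) :: ts u ∧ R = tr P') := by
  have hm : (x :: w, c) ∈ tr P := by rw [h]; simp
  obtain ⟨⟨u, b⟩, hu, he⟩ := mem_map.1 hm
  rw [transSub_eq, Prod.mk.injEq] at he
  obtain ⟨h1, rfl⟩ := he
  obtain ⟨P', rfl⟩ := exists_cons_of_mem hu
  rw [tr_cons, h1, cons_inj_right] at h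
  cases u with
  | nil => simp [ts_nil] at h1
  | cons d u =>
    cases d with
    | bang =>
      left
      rw [ts_bang, List.cons.injEq] at h1
      exact ⟨u, P', rfl, h1.1.symm, h1.2.symm, h.symm⟩
    | ques =>
      right
      rw [ts_ques, List.cons.injEq] at h1
      exact ⟨u, P', rfl, h1.1.symm, h1.2.symm, h.symm⟩

lemma inv_tr {P : SProc} {s : Store 3} {M' s'} (h : LockStep (tr P, s) (M', s')) :
    (s 0 = false ∧ ∃ u b P', P = (SSym.bang :: u, b) ::ₘ P' ∧
      M' = ((LOp.take, 2) :: (LOp.put, 1) :: (LOp.take, 0) :: ts u, b) ::ₘ tr P' ∧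
      s' = Function.update s 0 true) ∨
    (s 2 = false ∧ ∃ u b P', P = (SSym.ques :: u, b) ::ₘ P' ∧
      M' = ((LOp.take, 1) :: ts u, b) ::ₘ tr P' ∧ s' = Function.update s 2 true) := by
  obtain ⟨i, w, b, R, ⟨h1, h2, h3, h4⟩ | ⟨h1, h3, h4⟩⟩ := h
  · simp only at h1 h2 h3 h4
    subst h3 h4
    rcases tr_inv h1 with ⟨u, P', rfl, hx, rfl, rfl⟩ | ⟨u, P', rfl, hx, rfl, rfl⟩
    · simp only [Prod.mk.injEq, true_and] at hx
      subst hx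
      left; exact ⟨h2, u, b, P', rfl, rfl, rfl⟩
    · simp only [Prod.mk.injEq, true_and] at hx
      subst hx
      right; exact ⟨h2, u, b, P', rfl, rfl, rfl⟩
  · simp only at h1
    rcases tr_inv h1 with ⟨u, P', rfl, hx, rfl, rfl⟩ | ⟨u, P', rfl, hx, rfl, rfl⟩
    · simp at hx
    · simp at hx

lemma sim_step {X Y : LProc 3 × Store 3} {P : SProc} (h : Rel X P) (hst : LockStep X Y) :
    ∃ Q, ReflTransGen SysStep P Q ∧ Rel Y Q := by
  cases h with
  | r0 =>
    obtain ⟨M, s⟩ := Y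
    rcases inv_tr hst with ⟨-, u, b, P', rfl, rfl, rfl⟩ | ⟨h, -⟩
    · exact ⟨_, .refl, by rw [u1]; exact .r1 u b P'⟩
    · simp at h
  | r1 u b P =>
    rcases inv1 hst with ⟨i, w, h, -⟩ | ⟨i, w, h, rfl⟩ | ⟨M', s', h, rfl⟩
    · simp at h
    · simp only [Prod.mk.injEq, List.cons.injEq, true_and, and_true] at h
      obtain ⟨rfl, rfl⟩ := h
      exact ⟨_, .refl, by rw [u2]; exact .r2 u b P⟩
    · rcases inv_tr h with ⟨h, -⟩ | ⟨h, -⟩ <;> simp at h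
  | r2 u b P =>
    rcases inv1 hst with ⟨i, w, h, hs, -⟩ | ⟨i, w, h, rfl⟩ | ⟨M', s', h, rfl⟩
    · simp only [Prod.mk.injEq, List.cons.injEq, true_and, and_true] at h
      rw [← h.1] at hs; simp at hs
    · simp at h
    · rcases inv_tr h with ⟨h, -⟩ | ⟨h, v, b', P', rfl, rfl, rfl⟩
      · simp at h
      · exact ⟨_, .refl, by rw [u3]; exact .r3 u b v b' P'⟩
  | r3 u b v b' P =>
    rcases inv1 hst with ⟨i, w, h, hs, -⟩ | ⟨i, w, h, rfl⟩ | ⟨M', s', h, rfl⟩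
    · simp only [Prod.mk.injEq, List.cons.injEq, true_and, and_true] at h
      rw [← h.1] at hs; simp at hs
    · simp at h
    · rcases inv1 h with ⟨i, w, h, hs, -⟩ | ⟨i, w, h, he⟩ | ⟨M', s', h, -⟩
      · simp at h
      · simp only [Prod.mk.injEq, List.cons.injEq, true_and, and_true] at h he
        obtain ⟨rfl, rfl⟩ := h
        obtain ⟨rfl, rfl⟩ := he
        refine ⟨(u, b) ::ₘ (v, b') ::ₘ P, .single ⟨u, v, b, b', P, rfl, rfl⟩, ?_⟩
        rw [u4, ← tr_cons]
        exact .r4 u b _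
      · rcases inv_tr h with ⟨h, -⟩ | ⟨h, -⟩ <;> simp at h
  | r4 u b P =>
    rcases inv1 hst with ⟨i, w, h, hs, rfl⟩ | ⟨i, w, h, rfl⟩ | ⟨M', s', h, rfl⟩
    · simp only [Prod.mk.injEq, List.cons.injEq, true_and, and_true] at h
      obtain ⟨rfl, rfl⟩ := h
      exact ⟨_, .refl, by rw [u5]; exact .r5 u b P⟩
    · simp at h
    · rcases inv_tr h with ⟨h, -⟩ | ⟨h, -⟩ <;> simp at h
  | r5 u b P =>
    rcases inv1 hst with ⟨i, w, h, hs, -⟩ | ⟨i, w, h, rfl⟩ | ⟨M', s', h, rfl⟩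
    · simp at h
    · simp only [Prod.mk.injEq, List.cons.injEq, true_and, and_true] at h
      obtain ⟨rfl, rfl⟩ := h
      refine ⟨_, .refl, ?_⟩
      rw [u6, ← tr_cons]
      exact .r0 _
    · rcases inv_tr h with ⟨h, -⟩ | ⟨h, -⟩ <;> simp at h

lemma sim {X Y : LProc 3 × Store 3} {P : SProc} (h : Rel X P) (hr : Reach X Y) :
    ∃ Q, ReflTransGen SysStep P Q ∧ Rel Y Q := by
  induction hr with
  | refl => exact ⟨P, .refl, h⟩
  | tail _ hst ih =>
    obtain ⟨Q, h1, h2⟩ := ih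
    obtain ⟨Q', h3, h4⟩ := sim_step h2 hst
    exact ⟨Q', h1.trans h3, h4⟩

lemma rel_succ {X : LProc 3 × Store 3} {P : SProc} (h : Rel X P) (hs : LSuccessful X) :
    SSuccessful P := by
  cases h with
  | r0 => exact tr_succ.1 hs
  | r1 u b P =>
    simp only [LSuccessful, mem_cons, Prod.mk.injEq, reduceCtorEq, false_and, false_or] at hs
    exact mem_cons_of_mem (tr_succ.1 hs)
  | r2 u b P =>
    simp only [LSuccessful, mem_cons, Prod.mk.injEq, reduceCtorEq, false_and, false_or] at hs
    exact mem_cons_of_mem (tr_succ.1 hs)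
  | r3 u b v b' P =>
    simp only [LSuccessful, mem_cons, Prod.mk.injEq, reduceCtorEq, false_and, false_or] at hs
    exact mem_cons_of_mem (mem_cons_of_mem (tr_succ.1 hs))
  | r4 u b P =>
    simp only [LSuccessful, mem_cons, Prod.mk.injEq, reduceCtorEq, false_and, false_or] at hs
    exact mem_cons_of_mem (tr_succ.1 hs)
  | r5 u b P =>
    simp only [LSuccessful, mem_cons, Prod.mk.injEq, reduceCtorEq, false_and, false_or] at hs
    exact mem_cons_of_mem (tr_succ.1 hs)

/-- From stage `r5` back to `r0`. -/
lemma g5 (u b P) : Reach (((LOp.take, 0) :: ts u, b) ::ₘ tr P, sFFF) (tr ((u, b) ::ₘ P), sIS) := by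
  have := step_take 0 (ts u) b (tr P) sFFF
  rw [u6, ← tr_cons] at this
  exact .single this

lemma g4 (u b P) : Reach (((LOp.put, 1) :: (LOp.take, 0) :: ts u, b) ::ₘ tr P, sFEF)
    (tr ((u, b) ::ₘ P), sIS) := by
  have := step_put 1 ((LOp.take, 0) :: ts u) b (tr P) sFEF rfl
  rw [u5] at this
  exact .head this (g5 u b P)

lemma g3 (u b v b' P) : Reach (((LOp.put, 1) :: (LOp.take, 0) :: ts u, b) ::ₘ
      ((LOp.take, 1) :: ts v, b') ::ₘ tr P, sFFF) (tr ((u, b) ::ₘ (v, b') ::ₘ P), sIS) := by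
  have := step_take 1 (ts v) b' (((LOp.put, 1) :: (LOp.take, 0) :: ts u, b) ::ₘ tr P) sFFF
  rw [u4, cons_swap, cons_swap (ts v, b'), ← tr_cons] at this
  exact .head this (g4 u b _)

lemma g2 (u b v b' P) : Reach (((LOp.put, 1) :: (LOp.take, 0) :: ts u, b) ::ₘ
      tr ((SSym.ques :: v, b') ::ₘ P), sFFE) (tr ((u, b) ::ₘ (v, b') ::ₘ P), sIS) := by
  have := step_put 2 ((LOp.take, 1) :: ts v) b'
    (((LOp.put, 1) :: (LOp.take, 0) :: ts u, b) ::ₘ tr P) sFFE rfl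
  rw [u3, cons_swap, cons_swap ((LOp.take, 1) :: ts v, b'), ← ts_ques, ← tr_cons] at this
  exact .head this (g3 u b v b' P)

lemma g1 (u b P) : LockStep (((LOp.take, 2) :: (LOp.put, 1) :: (LOp.take, 0) :: ts u, b) ::ₘ tr P,
    sFFF) (((LOp.put, 1) :: (LOp.take, 0) :: ts u, b) ::ₘ tr P, sFFE) := by
  have := step_take 2 ((LOp.put, 1) :: (LOp.take, 0) :: ts u) b (tr P) sFFF
  rwa [u2] at this

lemma g0 (u b P) : LockStep (tr ((SSym.bang :: u, b) ::ₘ P), sIS)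
    (((LOp.take, 2) :: (LOp.put, 1) :: (LOp.take, 0) :: ts u, b) ::ₘ tr P, sFFF) := by
  have := step_put 0 ((LOp.take, 2) :: (LOp.put, 1) :: (LOp.take, 0) :: ts u) b (tr P) sIS rfl
  rwa [u1, ← ts_bang, ← tr_cons] at this

lemma fwd {P Q : SProc} (h : ReflTransGen SysStep P Q) : Reach (tr P, sIS) (tr Q, sIS) := by
  induction h with
  | refl => exact .refl
  | tail _ hst ih =>
    obtain ⟨u1, u2, b1, b2, R, rfl, rfl⟩ := hst
    exact ih.trans (.head (g0 _ _ _) (.head (g1 _ _ _) (g2 _ _ _ _ _)))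

lemma fwd_may {P : SProc} (h : SMayConv P) : LMayConv (tr P, sIS) := by
  obtain ⟨Q, h1, h2⟩ := h
  exact ⟨_, fwd h1, tr_succ.2 h2⟩

lemma may_of_reach {X Y : LProc 3 × Store 3} (h : Reach X Y) (hY : LMayConv Y) : LMayConv X := by
  obtain ⟨Z, h1, h2⟩ := hY
  exact ⟨Z, h.trans h1, h2⟩

lemma may2 {u b P} (h : SMustConv ((SSym.bang :: u, b) ::ₘ P)) :
    LMayConv (((LOp.put, 1) :: (LOp.take, 0) :: ts u, b) ::ₘ tr P, sFFE) := by
  by_cases hq : ∃ v b', (SSym.ques :: v, b') ∈ P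
  · obtain ⟨v, b', hv⟩ := hq
    obtain ⟨R, rfl⟩ := exists_cons_of_mem hv
    exact may_of_reach (g2 u b v b' R)
      (fwd_may (h _ (.single ⟨u, v, b, b', R, rfl, rfl⟩)))
  · obtain ⟨Q, hr, hs⟩ := h _ .refl
    rcases ReflTransGen.cases_head hr with rfl | ⟨Y, ⟨u1, u2, b1, b2, R, he, -⟩, -⟩
    · refine ⟨_, .refl, ?_⟩
      have : SSuccessful P := by simpa [SSuccessful] using hs
      exact mem_cons_of_mem (tr_succ.2 this)
    · exfalso
      apply hq
      have : (SSym.ques :: u2, b2) ∈ (SSym.bang :: u, b) ::ₘ P := by rw [he]; simp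
      exact ⟨u2, b2, by simpa using this⟩

lemma rel_may {X : LProc 3 × Store 3} {P : SProc} (h : Rel X P) (hm : SMustConv P) :
    LMayConv X := by
  cases h with
  | r0 => exact fwd_may (hm _ .refl)
  | r1 u b P => exact may_of_reach (.single (g1 u b P)) (may2 hm)
  | r2 u b P => exact may2 hm
  | r3 u b v b' P =>
    exact may_of_reach (g3 u b v b' P) (fwd_may (hm _ (.single ⟨u, v, b, b', P, rfl, rfl⟩)))
  | r4 u b P => exact may_of_reach (g4 u b P) (fwd_may (hm _ .refl))
  | r5 u b P => exact may_of_reach (g5 u b P) (fwd_may (hm _ .refl))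

theorem part_two : Correct IS3 tb3 tq3 := by
  intro P
  refine ⟨⟨fwd_may, ?_⟩, ⟨?_, ?_⟩⟩
  · rintro ⟨Y, hr, hs⟩
    obtain ⟨Q, h1, h2⟩ := sim (.r0 P) hr
    exact ⟨Q, h1, rel_succ h2 hs⟩
  · intro h Y hr
    obtain ⟨Q, h1, h2⟩ := sim (.r0 P) hr
    exact rel_may h2 (fun Q' hQ' => h Q' (h1.trans hQ'))
  · intro h Q hQ
    obtain ⟨Y, hr, hs⟩ := h _ (fwd hQ)
    obtain ⟨Q', h1, h2⟩ := sim (.r0 Q) hr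
    exact ⟨Q', h1, rel_succ h2 hs⟩

end three

end TL

/-- no compositional translation into LOCKSIMPLE with two locks is
correct (for any initial store), while three locks suffice (witnessed by
`τ(!) = P_1T_3P_2T_1`, `τ(?) = P_3T_2` and initial store `(□,■,■)`). -/
theorem two_locks_insufficient_three_suffice :
    (∀ (IS : Store 2) (tb tq : List (LSym 2)), ¬ Correct IS tb tq) ∧
    Correct IS3 tb3 tq3 := by exact ⟨TL.part_one, TL.part_two⟩
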